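/- arXiv:1009.3676 — 5 statements merged into one kernel-verified Lean document; each statement's English description precedes it below -/
import Mathlib

section
/- Let d ≥ 0, n > d, and let T = {T_1,…,T_l} ∈ L(n,d) with l ≥ 1. Then the poset ideal I_{n,d}(T) is isomorphic, as a poset, to the direct product ∏_{i=1}^l I_{n,d}({T_i}) of the poset ideals generated by the singleton collections {T_i}, equipped with the componentwise partial order. -/
attribute [local instance] Classical.propDecidable

/-- Collections of subsets of `{1,…,n}` (modelled as `Fin n`). -/
abbrev Coll (n : ℕ) := Finset (Finset (Fin n))

/-- `codim_d X = d + 1 - |X|`. -/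
def codim {n : ℕ} (d : ℕ) (X : Finset (Fin n)) : ℤ := (d : ℤ) + 1 - X.card

/-- `ρ_d T = Σ_{X ∈ T} codim_d X`. -/
def rho {n : ℕ} (d : ℕ) (T : Coll n) : ℤ := ∑ X ∈ T, codim d X

/-- `D_d T = codim_d (T_1 ∩ … ∩ T_l) - ρ_d T` (used when `|T| ≥ 2`). -/
def Dd {n : ℕ} (d : ℕ) (T : Coll n) : ℤ := codim d (T.inf id) - rho d T

/-- Membership in the lattice `L(n,d)`. -/
def memL (n d : ℕ) (T : Coll n) : Prop :=
  (∀ T' ⊆ T, 2 ≤ T'.card → 0 < Dd d T') ∧ ∀ X ∈ T, X.card ≤ d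

/-- The intersection lattice `L(n,d)`. -/
structure L (n d : ℕ) where
  val : Coll n
  mem : memL n d val

namespace L

instance (n d : ℕ) : PartialOrder (L n d) where
  le S T := S = T ∨ (rho d S.val < rho d T.val ∧ ∀ X ∈ S.val, ∃ Y ∈ T.val, Y ⊆ X)
  le_refl S := Or.inl rfl
  le_trans S T U hST hTU := by
    rcases hST with rfl | hST
    · exact hTU
    · rcases hTU with rfl | hTU
      · exact Or.inr hST
      · refine Or.inr ⟨hST.1.trans hTU.1, fun X hX => ?_⟩
        obtain ⟨Y, hY, hYX⟩ := hST.2 X hX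
        obtain ⟨Z, hZ, hZY⟩ := hTU.2 Y hY
        exact ⟨Z, hZ, hZY.trans hYX⟩
  le_antisymm S T hST hTS := by
    rcases hST with rfl | hST
    · rfl
    · rcases hTS with rfl | hTS
      · rfl
      · exact absurd (hST.1.trans hTS.1) (lt_irrefl _)

noncomputable instance (n d : ℕ) : Fintype (L n d) :=
  Fintype.ofInjective (fun T : L n d => T.val)
    (fun a b h => by cases a; cases b; simpa using h)

end L

/-- The minimum element `∅` of `L(n,d)`. -/
def Lbot (n d : ℕ) : L n d :=
  ⟨∅, by
    constructor
    · intro T' hT' h2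
      rw [Finset.subset_empty] at hT'
      subst hT'
      simp at h2
    · intro X hX
      simp at hX⟩

/-- The maximum element `{∅}` of `L(n,d)`. -/
def Ltop (n d : ℕ) : L n d :=
  ⟨{∅}, by
    constructor
    · intro T' hT' h2
      have h1 : T'.card ≤ 1 := (Finset.card_le_card hT').trans_eq (Finset.card_singleton _)
      exact absurd h2 (by omega)
    · intro X hX
      rw [Finset.mem_singleton] at hX
      subst hX
      simp⟩

/-- The singleton collection `{X}` as an element of `L(n,d)`. -/
def singL (n d : ℕ) (X : Finset (Fin n)) (hX : X.card ≤ d) : L n d :=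
  ⟨{X}, by
    constructor
    · intro T' hT' h2
      have h1 : T'.card ≤ 1 := (Finset.card_le_card hT').trans_eq (Finset.card_singleton _)
      exact absurd h2 (by omega)
    · intro Y hY
      rw [Finset.mem_singleton] at hY
      subst hY
      exact hX⟩

/-- The type of `T ∈ L(n,d)`: the multiset of codimensions of its members. -/
def typeOf {n : ℕ} (d : ℕ) (T : L n d) : Multiset ℕ :=
  T.val.val.map (fun X => d + 1 - X.card)

/-- `λ_{n,d}(γ)`: the number of elements of `L(n,d)` of type `γ`. -/
noncomputable def lam (n d : ℕ) (γ : Multiset ℕ) : ℕ :=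
  (Finset.univ.filter (fun T : L n d => typeOf d T = γ)).card

/-- `κ_{n,d}(m,T)`: the number of `m`-element sets of `d`-element subsets of `{1,…,n}`
whose corresponding hyperplanes have least upper bound `T` in `L(n,d)`. -/
noncomputable def kappa (n d m : ℕ) (T : L n d) : ℕ :=
  (Finset.univ.filter (fun H : Coll n =>
      H.card = m ∧ (∀ X ∈ H, X.card = d) ∧
      IsLUB {S : L n d | ∃ X ∈ H, S.val = {X}} T)).card

section Collections

variable {n d : ℕ}

lemma L.ext_val {S T : L n d} (h : S.val = T.val) : S = T := by
  cases S
  cases T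
  cases h
  rfl

lemma memL.mono {S T : Coll n} (hT : memL n d T) (h : S ⊆ T) : memL n d S :=
  ⟨fun U hU => hT.1 U (hU.trans h), fun X hX => hT.2 X (h hX)⟩

/-- A subset with at most `d` elements contains at most one member of a collection
in `L(n,d)`. -/
lemma memL.eq_of_subset {T : Coll n} (hT : memL n d T) {X Y Z : Finset (Fin n)}
    (hY : Y ∈ T) (hZ : Z ∈ T) (hX : X.card ≤ d) (hYX : Y ⊆ X) (hZX : Z ⊆ X) : Y = Z := by
  by_contra hne
  have h := hT.1 {Y, Z} (Finset.insert_subset hY (Finset.singleton_subset_iff.2 hZ))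
    (Finset.card_pair hne).ge
  have hinf : ({Y, Z} : Coll n).inf id = Y ∩ Z := by simp
  rw [Dd, rho, Finset.sum_pair hne, hinf] at h
  simp only [codim] at h
  have h1 := Finset.card_union_add_card_inter Y Z
  have h2 := Finset.card_le_card (Finset.union_subset hYX hZX)
  omega

/-- The members of a collection in `L(n,d)` have total codimension at most that of their
intersection. -/
lemma memL.rho_le {S : Coll n} (hS : memL n d S) (hne : S.Nonempty) :
    rho d S ≤ codim d (S.inf id) := by
  rcases (Nat.succ_le_of_lt hne.card_pos).eq_or_lt with h | h
  · obtain ⟨X, rfl⟩ := Finset.card_eq_one.1 h.symm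
    simp [rho]
  · have := hS.1 S subset_rfl h
    rw [Dd] at this
    omega

lemma codim_anti {X Y : Finset (Fin n)} (h : X ⊆ Y) : codim d Y ≤ codim d X := by
  have := Finset.card_le_card h
  simp only [codim]
  omega

lemma memL.rho_le_codim {S : Coll n} (hS : memL n d S) {Y : Finset (Fin n)} (hY : Y.card ≤ d)
    (h : ∀ X ∈ S, Y ⊆ X) : rho d S ≤ codim d Y := by
  rcases S.eq_empty_or_nonempty with rfl | hne
  · simp only [rho, Finset.sum_empty, codim]
    omega
  · exact (hS.rho_le hne).trans (codim_anti (Finset.le_inf h))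

lemma memL.eq_singleton_of_codim_le {S : Coll n} (hS : memL n d S) {Y : Finset (Fin n)}
    (hY : Y.card ≤ d) (h : ∀ X ∈ S, Y ⊆ X) (hle : codim d Y ≤ rho d S) : S = {Y} := by
  rcases S.eq_empty_or_nonempty with rfl | hne
  · simp only [rho, Finset.sum_empty, codim] at hle
    omega
  rcases (Nat.succ_le_of_lt hne.card_pos).eq_or_lt with h1 | h1
  · obtain ⟨X, rfl⟩ := Finset.card_eq_one.1 h1.symm
    simp only [rho, Finset.sum_singleton, codim] at hle
    rw [Finset.eq_of_subset_of_card_le (h X (Finset.mem_singleton_self X)) (by omega)]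
  · have h2 := hS.1 S subset_rfl h1
    have h3 : codim d (S.inf id) ≤ codim d Y := codim_anti (Finset.le_inf h)
    rw [Dd] at h2
    omega

/-- The part of the collection `S` lying above `Y`. -/
noncomputable def above (S : Coll n) (Y : Finset (Fin n)) : Coll n := S.filter (Y ⊆ ·)

lemma mem_above {S : Coll n} {X Y : Finset (Fin n)} : X ∈ above S Y ↔ X ∈ S ∧ Y ⊆ X :=
  Finset.mem_filter

lemma above_subset (S : Coll n) (Y : Finset (Fin n)) : above S Y ⊆ S :=
  Finset.filter_subset _ _

lemma biUnion_above {S T : Coll n} (h : ∀ X ∈ S, ∃ Y ∈ T, Y ⊆ X) : T.biUnion (above S) = S := by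
  ext X
  simp only [Finset.mem_biUnion, mem_above]
  constructor
  · rintro ⟨_, _, hX, _⟩
    exact hX
  · intro hX
    obtain ⟨Y, hY, hYX⟩ := h X hX
    exact ⟨Y, hY, hX, hYX⟩

lemma memL.rho_eq_sum_above {S T : Coll n} (hT : memL n d T) (hS : ∀ X ∈ S, X.card ≤ d)
    (h : ∀ X ∈ S, ∃ Y ∈ T, Y ⊆ X) : rho d S = ∑ Y ∈ T, rho d (above S Y) := by
  conv_lhs => rw [← biUnion_above h]
  refine Finset.sum_biUnion fun Y hY Z hZ hne => Finset.disjoint_left.2 fun X hXY hXZ => hne ?_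
  rw [mem_above] at hXY hXZ
  exact hT.eq_of_subset hY hZ (hS X hXY.1) hXY.2 hXZ.2

/-- The order on `L(n,d)` is plain refinement. -/
lemma L.le_iff {S T : L n d} : S ≤ T ↔ ∀ X ∈ S.val, ∃ Y ∈ T.val, Y ⊆ X := by
  constructor
  · rintro (rfl | h)
    · exact fun X hX => ⟨X, hX, subset_rfl⟩
    · exact h.2
  · intro h
    have hrho := T.mem.rho_eq_sum_above S.mem.2 h
    have hmem (Y) : memL n d (above S.val Y) := S.mem.mono (above_subset _ _)
    have hle : ∀ Y ∈ T.val, rho d (above S.val Y) ≤ codim d Y := fun Y hY =>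
      (hmem Y).rho_le_codim (T.mem.2 Y hY) fun X hX => (mem_above.1 hX).2
    by_cases hlt : rho d S.val < rho d T.val
    · exact Or.inr ⟨hlt, h⟩
    · left
      have heq : ∑ Y ∈ T.val, rho d (above S.val Y) = ∑ Y ∈ T.val, codim d Y :=
        le_antisymm (Finset.sum_le_sum hle) (by rw [← hrho]; exact not_lt.1 hlt)
      have hval : S.val = T.val := by
        rw [← biUnion_above h]
        conv_rhs => rw [← Finset.biUnion_singleton_eq_self (s := T.val)]
        refine Finset.biUnion_congr rfl fun Y hY => ?_
        exact (hmem Y).eq_singleton_of_codim_le (T.mem.2 Y hY) (fun X hX => (mem_above.1 hX).2)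
          ((Finset.sum_eq_sum_iff_of_le hle).1 heq Y hY).ge
      exact L.ext_val hval

/-- Enlarging the members of a family by some amount enlarges the intersection by at most
the total amount. -/
lemma card_inf_add_sum_card_le (J : Coll n) (P : Finset (Fin n) → Finset (Fin n))
    (hP : ∀ Y ∈ J, Y ⊆ P Y) :
    (J.inf P).card + ∑ Y ∈ J, Y.card ≤ (J.inf id).card + ∑ Y ∈ J, (P Y).card := by
  have hsub : J.inf P \ J.inf id ⊆ J.biUnion fun Y => P Y \ Y := by
    intro x hx
    simp only [Finset.mem_sdiff, Finset.mem_inf, id, not_forall] at hx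
    obtain ⟨hx, Y, hY, hxY⟩ := hx
    exact Finset.mem_biUnion.2 ⟨Y, hY, Finset.mem_sdiff.2 ⟨hx Y hY, hxY⟩⟩
  have h1 := (Finset.card_le_card hsub).trans Finset.card_biUnion_le
  have h2 : ∑ Y ∈ J, (P Y \ Y).card + ∑ Y ∈ J, Y.card = ∑ Y ∈ J, (P Y).card := by
    rw [← Finset.sum_add_distrib]
    exact Finset.sum_congr rfl fun Y hY => Finset.card_sdiff_add_card_eq_card (hP Y hY)
  have h3 := Finset.le_card_sdiff (J.inf id) (J.inf P)
  omega

lemma Dd_le_codim_inf_sub (J : Coll n) (P : Finset (Fin n) → Finset (Fin n))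
    (hP : ∀ Y ∈ J, Y ⊆ P Y) :
    Dd d J ≤ codim d (J.inf P) - ∑ Y ∈ J, codim d (P Y) := by
  have h := card_inf_add_sum_card_le J P hP
  zify at h
  simp only [Dd, rho, codim, Finset.sum_sub_distrib]
  linarith

/-- A refinement of a member of `L(n,d)` is in `L(n,d)` as soon as its parts are. -/
lemma memL.of_above {S T : Coll n} (hT : memL n d T) (h : ∀ X ∈ S, ∃ Y ∈ T, Y ⊆ X)
    (hS : ∀ Y ∈ T, memL n d (above S Y)) : memL n d S := by
  have hcard : ∀ X ∈ S, X.card ≤ d := fun X hX => by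
    obtain ⟨Y, hY, hYX⟩ := h X hX
    exact (hS Y hY).2 X (mem_above.2 ⟨hX, hYX⟩)
  refine ⟨fun U hU hU2 => ?_, hcard⟩
  have habove (Y) : above U Y ⊆ above S Y := Finset.filter_subset_filter _ hU
  set J : Coll n := T.filter fun Y => (above U Y).Nonempty
  have hJT : J ⊆ T := Finset.filter_subset _ _
  have hUJ : ∀ X ∈ U, ∃ Y ∈ J, Y ⊆ X := fun X hX => by
    obtain ⟨Y, hY, hYX⟩ := h X (hU hX)
    exact ⟨Y, Finset.mem_filter.2 ⟨hY, X, mem_above.2 ⟨hX, hYX⟩⟩, hYX⟩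
  have hbU := biUnion_above hUJ
  rcases Nat.lt_or_ge J.card 2 with hJ2 | hJ2
  · obtain ⟨Y, hY⟩ : ∃ Y, J ⊆ {Y} :=
      Finset.card_le_one_iff_subset_singleton.1 (by omega)
    obtain ⟨X, hX⟩ := Finset.card_pos.1 (show 0 < U.card by omega)
    obtain ⟨Z, hZ, -⟩ := hUJ X hX
    obtain rfl := Finset.mem_singleton.1 (hY hZ)
    refine (hS Z (hJT hZ)).1 U (fun W hW => ?_) hU2
    obtain ⟨V, hV, hVW⟩ := hUJ W hW
    obtain rfl := Finset.mem_singleton.1 (hY hV)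
    exact mem_above.2 ⟨hU hW, hVW⟩
  · have hpos := hT.1 J hJT hJ2
    have hDd := Dd_le_codim_inf_sub (d := d) J (fun Y => (above U Y).inf id)
      fun Y _ => Finset.le_inf fun X hX => (mem_above.1 hX).2
    have hinf : U.inf id = J.inf fun Y => (above U Y).inf id := by
      conv_lhs => rw [← hbU]
      exact Finset.inf_biUnion _ _
    have hrho : rho d U ≤ ∑ Y ∈ J, codim d ((above U Y).inf id) := by
      rw [(hT.mono hJT).rho_eq_sum_above (fun X hX => hcard X (hU hX)) hUJ]
      exact Finset.sum_le_sum fun Y hY =>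
        ((hS Y (hJT hY)).mono (habove Y)).rho_le (Finset.mem_filter.1 hY).2
    rw [Dd, hinf]
    linarith

lemma le_singL_iff {S : L n d} {Y : Finset (Fin n)} (hY : Y.card ≤ d) :
    S ≤ singL n d Y hY ↔ ∀ X ∈ S.val, Y ⊆ X := by
  simp [L.le_iff, singL]

/-- The part of `S` above `Y`, as an element of the ideal generated by `{Y}`. -/
noncomputable def aboveIdeal (S : L n d) (Y : Finset (Fin n)) (hY : Y.card ≤ d) :
    {S : L n d // S ≤ singL n d Y hY} :=
  ⟨⟨above S.val Y, S.mem.mono (above_subset _ _)⟩,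
    (le_singL_iff hY).2 fun _ hX => (mem_above.1 hX).2⟩

end Collections

/-- For `T = {T_1,…,T_l} ∈ L(n,d)` with `l ≥ 1`, the poset ideal
`I_{n,d}(T)` is isomorphic, as a poset, to the direct product
`∏_{i=1}^l I_{n,d}({T_i})` with the componentwise order. -/
theorem ideal_orderIso_prod_ideals (n d : ℕ) (hnd : d < n) (T : L n d)
    (hT : T.val.Nonempty) :
    Nonempty ({S : L n d // S ≤ T} ≃o
      ((X : {Y : Finset (Fin n) // Y ∈ T.val}) →
        {S : L n d // S ≤ singL n d X.1 (T.mem.2 X.1 X.2)})) := by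
  let f : {S : L n d // S ≤ T} ↪o ((X : {Y : Finset (Fin n) // Y ∈ T.val}) →
        {S : L n d // S ≤ singL n d X.1 (T.mem.2 X.1 X.2)}) :=
    OrderEmbedding.ofMapLEIff (fun S Y => aboveIdeal S.1 Y.1 (T.mem.2 Y.1 Y.2)) <| by
      rintro ⟨S, hS⟩ ⟨S', hS'⟩
      rw [L.le_iff] at hS hS'
      rw [Pi.le_def]
      simp only [← Subtype.coe_le_coe, L.le_iff, aboveIdeal, mem_above]
      constructor
      · intro h X hX
        obtain ⟨Y, hY, hYX⟩ := hS X hX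
        obtain ⟨Z, hZ, hZX⟩ := h ⟨Y, hY⟩ X ⟨hX, hYX⟩
        exact ⟨Z, hZ.1, hZX⟩
      · rintro h ⟨Y, hY⟩ X ⟨hX, hYX⟩
        obtain ⟨Z, hZ, hZX⟩ := h X hX
        obtain ⟨V, hV, hVZ⟩ := hS' Z hZ
        obtain rfl := T.mem.eq_of_subset hY hV (S.mem.2 X hX) hYX (hVZ.trans hZX)
        exact ⟨Z, ⟨hZ, hVZ⟩, hZX⟩
  refine ⟨RelIso.ofSurjective f fun g => ?_⟩
  have hg (Y) : ∀ X ∈ (g Y).1.val, Y.1 ⊆ X := (le_singL_iff (T.mem.2 Y.1 Y.2)).1 (g Y).2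
  set W : Coll n := T.val.attach.biUnion fun Y => (g Y).1.val
  have hWT : ∀ X ∈ W, ∃ Y ∈ T.val, Y ⊆ X := fun X hX => by
    obtain ⟨Y, -, hXY⟩ := Finset.mem_biUnion.1 hX
    exact ⟨Y.1, Y.2, hg Y X hXY⟩
  have hWg (Y : {Y : Finset (Fin n) // Y ∈ T.val}) : above W Y.1 = (g Y).1.val := by
    ext X
    rw [mem_above, Finset.mem_biUnion]
    constructor
    · rintro ⟨⟨Z, -, hXZ⟩, hYX⟩
      obtain rfl := Subtype.ext
        (T.mem.eq_of_subset Y.2 Z.2 ((g Z).1.mem.2 X hXZ) hYX (hg Z X hXZ))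
      exact hXZ
    · exact fun hX => ⟨⟨Y, Finset.mem_attach _ _, hX⟩, hg Y X hX⟩
  have hWL : memL n d W := T.mem.of_above hWT fun Y hY => by
    rw [hWg ⟨Y, hY⟩]
    exact (g ⟨Y, hY⟩).1.mem
  refine ⟨⟨⟨W, hWL⟩, L.le_iff.2 hWT⟩, funext fun Y => Subtype.ext ?_⟩
  exact L.ext_val (hWg Y)
end

section
/- Let d ≥ 0, n > d, and let T, T' ∈ L(n,d) with T < T'. Then for each member T_i ∈ T there exists exactly one member T'_j ∈ T' such that T'_j ⊆ T_i. -/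
attribute [local instance] Classical.propDecidable

/-- If `T < T'` in `L(n,d)`, then for each member `T_i ∈ T` there is
exactly one member `T'_j ∈ T'` with `T'_j ⊆ T_i`. -/
theorem unique_member_subset (n d : ℕ) (hnd : d < n) (T T' : L n d) (h : T < T') :
    ∀ X ∈ T.val, ∃! Y, Y ∈ T'.val ∧ Y ⊆ X := by
  intro X hX
  obtain ⟨-, hsub⟩ := h.le.resolve_left h.ne
  obtain ⟨Y, hY, hYX⟩ := hsub X hX
  refine ⟨Y, ⟨hY, hYX⟩, fun Z ⟨hZ, hZX⟩ => ?_⟩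
  by_contra hne
  have hD := T'.mem.1 {Z, Y} (by simp [Finset.insert_subset_iff, hY, hZ])
    (Finset.card_pair hne).ge
  simp only [Dd, rho, codim, Finset.sum_pair hne, Finset.inf_insert, Finset.inf_singleton,
    id_eq, Finset.inf_eq_inter] at hD
  have hinter := Finset.card_union_add_card_inter Z Y
  have hunion := Finset.card_le_card (Finset.union_subset hZX hYX)
  have hcard := T.mem.2 X hX
  omega
end

section
/- Let d ≥ 0, let T_1,…,T_l (l ≥ 1) be finite sets, and for each i = 1,…,l let S^{(i)}_1,…,S^{(i)}_{m_i} (m_i ≥ 1) be finite sets with T_i ⊆ S^{(i)}_j for all i and j. Assume D_d(T_1,…,T_l) > 0 and, for each i with m_i ≥ 2, D_d(S^{(i)}_1,…,S^{(i)}_{m_i}) > 0. Then D_d(S) > 0, where S is the concatenated tuple (S^{(1)}_1,…,S^{(1)}_{m_1}, S^{(2)}_1,…,S^{(2)}_{m_2}, …, S^{(l)}_1,…,S^{(l)}_{m_l}) of length m_1 + … + m_l. -/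
/-- `D_d(T_1,…,T_l) = −(l−1)(d+1) + Σ_{i} |T_i| − |T_1 ∩ … ∩ T_l|` for a tuple of
finite sets indexed by a finite type (of cardinality `l`). -/
noncomputable def Dtup {ι α : Type*} [Fintype ι] (d : ℕ) (T : ι → Finset α) : ℤ :=
  -((Fintype.card ι : ℤ) - 1) * ((d : ℤ) + 1) + (∑ i, ((T i).card : ℤ))
    - (Set.ncard (⋂ i, ((T i : Set α))) : ℤ)

theorem finite_iInter_coe {ι α : Type*} [Nonempty ι] (T : ι → Finset α) :
    (⋂ i, (T i : Set α)).Finite :=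
  (T (Classical.arbitrary ι)).finite_toSet.subset (Set.iInter_subset _ _)

/-- `Dtup d` is monotone for componentwise inclusion. -/
theorem Dtup_mono {ι α : Type*} [Fintype ι] [Nonempty ι] (d : ℕ) {T U : ι → Finset α}
    (h : ∀ i, T i ⊆ U i) : Dtup d T ≤ Dtup d U := by
  classical
  have hsub : (⋂ i, (U i : Set α)) ⊆
      (⋂ i, (T i : Set α)) ∪ (Finset.univ.biUnion fun i => U i \ T i : Finset α) := by
    intro x hx
    by_cases hxT : ∀ i, x ∈ T i
    · exact Or.inl (Set.mem_iInter.2 hxT)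
    · obtain ⟨i, hi⟩ := not_forall.1 hxT
      have hxU : x ∈ U i := Set.mem_iInter.1 hx i
      exact Or.inr (by simpa using ⟨i, hxU, hi⟩)
  have hcard : (⋂ i, (U i : Set α)).ncard ≤
      (⋂ i, (T i : Set α)).ncard + ∑ i, (U i \ T i).card :=
    calc (⋂ i, (U i : Set α)).ncard
        ≤ _ := Set.ncard_le_ncard hsub ((finite_iInter_coe T).union (Finset.finite_toSet _))
      _ ≤ _ := Set.ncard_union_le _ _
      _ ≤ _ := by
        rw [Set.ncard_coe_finset]
        exact Nat.add_le_add_left Finset.card_biUnion_le _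
  have hsum : ∑ i, (U i).card = ∑ i, (U i \ T i).card + ∑ i, (T i).card := by
    rw [← Finset.sum_add_distrib]
    exact Finset.sum_congr rfl fun i _ => (Finset.card_sdiff_add_card_eq_card (h i)).symm
  unfold Dtup
  zify at hcard hsum
  linarith

/-- For a tuple indexed by a one-element type, `Dtup` vanishes. -/
theorem Dtup_eq_zero_of_subsingleton {ι α : Type*} [Fintype ι] [Nonempty ι] [Subsingleton ι]
    (d : ℕ) (T : ι → Finset α) : Dtup d T = 0 := by
  obtain ⟨_⟩ := nonempty_unique ι
  have hint : (⋂ i, (T i : Set α)) = T default := iInf_unique _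
  simp [Dtup, hint]

/-- `Dtup` of a concatenation is the sum of `Dtup` of the blocks and `Dtup` of the tuple of
block intersections. -/
theorem Dtup_sigma {ι α : Type*} [Fintype ι] {κ : ι → Type*} [∀ i, Fintype (κ i)] (d : ℕ)
    (S : (i : ι) → κ i → Finset α) (U : ι → Finset α)
    (hU : ∀ i, (U i : Set α) = ⋂ j, (S i j : Set α)) :
    Dtup d (fun p : (i : ι) × κ i => S p.1 p.2) = Dtup d U + ∑ i, Dtup d (S i) := by
  have hint : (⋂ p : (i : ι) × κ i, (S p.1 p.2 : Set α)) = ⋂ i, (U i : Set α) := by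
    simp_rw [hU]
    exact iInf_sigma
  simp only [Dtup, hint, ← hU, Set.ncard_coe_finset, Finset.sum_sub_distrib,
    Finset.sum_add_distrib, Fintype.card_sigma, Fintype.sum_sigma, ← Finset.sum_mul,
    Finset.sum_neg_distrib, Finset.sum_const, Finset.card_univ]
  push_cast
  ring

/-- Let `T_1,…,T_l` (`l ≥ 1`) be finite sets, and for each `i` let
`S^{(i)}_1,…,S^{(i)}_{m_i}` (`m_i ≥ 1`) be finite sets with `T_i ⊆ S^{(i)}_j` for
all `i, j`. If `D_d(T_1,…,T_l) > 0` and `D_d(S^{(i)}_1,…,S^{(i)}_{m_i}) > 0`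
whenever `m_i ≥ 2`, then `D_d(S) > 0` for the concatenated tuple `S` of length
`m_1 + … + m_l`. -/
theorem Dtup_concat_pos {α : Type*} (d l : ℕ) (hl : 1 ≤ l)
    (m : Fin l → ℕ) (hm : ∀ i, 1 ≤ m i)
    (T : Fin l → Finset α) (S : (i : Fin l) → Fin (m i) → Finset α)
    (hTS : ∀ i j, T i ⊆ S i j)
    (hT : 0 < Dtup d T)
    (hS : ∀ i, 2 ≤ m i → 0 < Dtup d (S i)) :
    0 < Dtup d (fun p : (i : Fin l) × Fin (m i) => S p.1 p.2) := by
  have : Nonempty (Fin l) := ⟨⟨0, hl⟩⟩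
  have : ∀ i, Nonempty (Fin (m i)) := fun i => ⟨⟨0, hm i⟩⟩
  let U : Fin l → Finset α := fun i => (finite_iInter_coe (S i)).toFinset
  have hU : ∀ i, (U i : Set α) = ⋂ j, (S i j : Set α) := fun i => Set.Finite.coe_toFinset _
  have hTU : ∀ i, T i ⊆ U i := fun i => by
    rw [← Finset.coe_subset, hU]
    exact Set.subset_iInter fun j => Finset.coe_subset.2 (hTS i j)
  have hblock : ∀ i, 0 ≤ Dtup d (S i) := fun i => by
    by_cases h : 2 ≤ m i
    · exact (hS i h).le
    · have : Subsingleton (Fin (m i)) := Fin.subsingleton_iff_le_one.2 (by omega)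
      exact (Dtup_eq_zero_of_subsingleton d (S i)).ge
  rw [Dtup_sigma d S U hU]
  exact add_pos_of_pos_of_nonneg (hT.trans_le (Dtup_mono d hTU))
    (Finset.sum_nonneg fun i _ => hblock i)
end

section
/- Let d, d' ≥ 0 and n > d, n' > d' with n − d = n' − d'. Let T = {T_1,…,T_l} ∈ L(n,d) and T' = {T'_1,…,T'_l} ∈ L(n',d') be collections with the same number l ≥ 1 of members, satisfying codim_d(T_i) = codim_{d'}(T'_i) for each i = 1,…,l. Then μ_{n,d}(T) = μ_{n',d'}(T'). -/
attribute [local instance] Classical.propDecidable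

namespace L

/-- In `L(n,d)`, two distinct members of a collection have no common superset of size `≤ d`. -/
lemma eq_of_subset_of_subset {n d : ℕ} {T : Coll n} (hT : memL n d T) {A B X : Finset (Fin n)}
    (hA : A ∈ T) (hB : B ∈ T) (hAX : A ⊆ X) (hBX : B ⊆ X) (hX : X.card ≤ d) : A = B := by
  by_contra hne
  have h := hT.1 {A, B} (by simp [Finset.insert_subset_iff, hA, hB])
    (by rw [Finset.card_pair hne])
  have hun := Finset.card_union_add_card_inter A B
  have hle := Finset.card_le_card (Finset.union_subset hAX hBX)
  simp only [Dd, rho, codim, Finset.sum_pair hne, Finset.inf_insert, Finset.inf_singleton, id,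
    Finset.inf_eq_inter] at h
  omega

/-- Any nonempty subcollection has `ρ_d` at most the codimension of its intersection. -/
lemma rho_le_codim_inf {n d : ℕ} {V : Coll n} (hV : V.Nonempty) (h : 2 ≤ V.card → 0 < Dd d V) :
    rho d V ≤ codim d (V.inf id) := by
  rcases Nat.lt_or_ge V.card 2 with h1 | h2
  · obtain ⟨X, rfl⟩ := Finset.card_eq_one.1 (by have := hV.card_pos; omega : V.card = 1)
    simp [rho]
  · have := h h2
    unfold Dd at this
    omega

lemma codim_anti {n : ℕ} (d : ℕ) {X Y : Finset (Fin n)} (h : X ⊆ Y) : codim d Y ≤ codim d X := by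
  have := Finset.card_le_card h
  unfold codim
  omega

/-- A subcollection all of whose members contain `Y` has `ρ_d` at most `codim_d Y`, with equality
only for `{Y}`. -/
lemma rho_lt_codim_or_eq {n d : ℕ} {V : Coll n} {Y : Finset (Fin n)} (hV : memL n d V)
    (hY : Y.card ≤ d) (h : ∀ X ∈ V, Y ⊆ X) : V = {Y} ∨ rho d V < codim d Y := by
  rcases V.eq_empty_or_nonempty with rfl | hne
  · right
    simp only [rho, codim, Finset.sum_empty]
    omega
  rcases Nat.lt_or_ge V.card 2 with h1 | h2
  · obtain ⟨X, rfl⟩ := Finset.card_eq_one.1 (by have := hne.card_pos; omega : V.card = 1)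
    have hYX := h X (by simp)
    rcases eq_or_ne Y X with rfl | hYne
    · simp
    · right
      have := Finset.card_lt_card (hYX.ssubset_of_ne hYne)
      simp only [rho, codim, Finset.sum_singleton]
      omega
  · right
    have h3 := hV.1 V subset_rfl h2
    have h4 : codim d (V.inf id) ≤ codim d Y := codim_anti d (Finset.le_inf h)
    unfold Dd at h3
    omega

lemma memL_of_subset {n d : ℕ} {S T : Coll n} (hT : memL n d T) (h : S ⊆ T) : memL n d S :=
  ⟨fun U hU => hT.1 U (hU.trans h), fun X hX => hT.2 X (h hX)⟩

/-- The order of `L(n,d)` is refinement alone. -/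
lemma le_iff_s8 {n d : ℕ} {S T : L n d} : S ≤ T ↔ ∀ X ∈ S.val, ∃ Y ∈ T.val, Y ⊆ X := by
  constructor
  · rintro (rfl | h)
    · exact fun X hX => ⟨X, hX, subset_rfl⟩
    · exact h.2
  intro h
  choose! p hpT hpX using h
  have hsum : rho d S.val = ∑ Y ∈ T.val, rho d (S.val.filter (fun X => p X = Y)) :=
    (Finset.sum_fiberwise_of_maps_to hpT _).symm
  have key : ∀ Y ∈ T.val, S.val.filter (fun X => p X = Y) = {Y} ∨
      rho d (S.val.filter (fun X => p X = Y)) < codim d Y := fun Y hY =>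
    rho_lt_codim_or_eq (memL_of_subset S.mem (Finset.filter_subset _ _)) (T.mem.2 Y hY) (by
      intro X hX
      rw [Finset.mem_filter] at hX
      exact hX.2 ▸ hpX X hX.1)
  have hle : ∀ Y ∈ T.val, rho d (S.val.filter (fun X => p X = Y)) ≤ codim d Y := by
    intro Y hY
    rcases key Y hY with h | h
    · rw [h]
      simp [rho]
    · exact h.le
  by_cases hall : ∀ Y ∈ T.val, S.val.filter (fun X => p X = Y) = {Y}
  · left
    have hST : S.val = T.val := by
      ext X
      constructor
      · intro hX
        have h1 : X ∈ S.val.filter (fun Z => p Z = p X) := by simp [hX]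
        rw [hall _ (hpT X hX), Finset.mem_singleton] at h1
        exact h1 ▸ hpT X hX
      · intro hX
        have h1 : X ∈ S.val.filter (fun Z => p Z = X) := by simp [hall X hX]
        exact (Finset.mem_filter.1 h1).1
    cases S
    cases T
    simpa using hST
  · right
    push Not at hall
    obtain ⟨Y, hY, hYne⟩ := hall
    refine ⟨?_, fun X hX => ⟨p X, hpT X hX, hpX X hX⟩⟩
    rw [hsum]
    exact Finset.sum_lt_sum hle ⟨Y, hY, (key Y hY).resolve_left hYne⟩

lemma Lbot_le {n d : ℕ} (S : L n d) : Lbot n d ≤ S := by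
  rw [le_iff_s8]
  simp [Lbot]

/-- A collection refining `T ∈ L(n,d)` lies in `L(n,d)` as soon as the parts above the single
members of `T` do. -/
lemma memL_of_fibers {n d : ℕ} {T U : Coll n} (hT : memL n d T)
    (p : Finset (Fin n) → Finset (Fin n))
    (hpT : ∀ X ∈ U, p X ∈ T) (hpX : ∀ X ∈ U, p X ⊆ X) (hd : ∀ X ∈ U, X.card ≤ d)
    (hU : ∀ A, ∀ V ⊆ U, (∀ X ∈ V, p X = A) → 2 ≤ V.card → 0 < Dd d V) : memL n d U := by
  refine ⟨fun V hVU hV => ?_, hd⟩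
  by_cases hconst : ∃ A, ∀ X ∈ V, p X = A
  · obtain ⟨A, hA⟩ := hconst
    exact hU A V hVU hA hV
  set I := V.image p with hI
  have hIcard : 2 ≤ I.card := by
    by_contra hlt
    have hVne : V.Nonempty := Finset.card_pos.1 (by omega)
    obtain ⟨A, hA⟩ := Finset.card_eq_one.1
      (by have := (hVne.image p).card_pos; rw [← hI] at this ⊢; omega : (V.image p).card = 1)
    exact hconst ⟨A, fun X hX => by
      simpa [hA] using Finset.mem_image_of_mem p hX⟩
  have hIT : I ⊆ T := by
    intro A hA
    obtain ⟨X, hX, rfl⟩ := Finset.mem_image.1 hA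
    exact hpT X (hVU hX)
  have hDI := hT.1 I hIT hIcard
  let Y : Finset (Fin n) → Finset (Fin n) := fun A => (V.filter (fun X => p X = A)).inf id
  have hAY : ∀ A, A ⊆ Y A := fun A => Finset.le_inf fun X hX => by
    rw [Finset.mem_filter] at hX
    exact hX.2 ▸ hpX X (hVU hX.1)
  have hsum : rho d V = ∑ A ∈ I, rho d (V.filter (fun X => p X = A)) :=
    (Finset.sum_fiberwise_of_maps_to (fun X hX => Finset.mem_image_of_mem p hX) _).symm
  have hrho : rho d V ≤ ∑ A ∈ I, codim d (Y A) := by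
    rw [hsum]
    refine Finset.sum_le_sum fun A hA => rho_le_codim_inf ?_ ?_
    · obtain ⟨X, hX, hXA⟩ := Finset.mem_image.1 hA
      exact ⟨X, Finset.mem_filter.2 ⟨hX, hXA⟩⟩
    · exact hU A _ ((Finset.filter_subset _ _).trans hVU) fun X hX => (Finset.mem_filter.1 hX).2
  have hsub : V.inf id ⊆ I.inf id ∪ I.biUnion (fun A => Y A \ A) := by
    intro x hx
    by_cases hxI : x ∈ I.inf id
    · exact Finset.mem_union_left _ hxI
    · refine Finset.mem_union_right _ ?_
      simp only [Finset.mem_inf, id] at hxI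
      push Not at hxI
      obtain ⟨A, hA, hxA⟩ := hxI
      have hVY : V.inf id ⊆ Y A := Finset.inf_mono (Finset.filter_subset _ _)
      exact Finset.mem_biUnion.2 ⟨A, hA, Finset.mem_sdiff.2 ⟨hVY hx, hxA⟩⟩
  have hcard : ((V.inf id).card : ℤ) ≤ (I.inf id).card + ∑ A ∈ I, ((Y A).card - A.card : ℤ) := by
    have h1 : (V.inf id).card ≤ (I.inf id).card + ∑ A ∈ I, (Y A \ A).card :=
      (Finset.card_le_card hsub).trans ((Finset.card_union_le _ _).trans
        (Nat.add_le_add_left Finset.card_biUnion_le _))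
    have h2 : ∀ A ∈ I, ((Y A \ A).card : ℤ) = (Y A).card - A.card := fun A _ =>
      Finset.cast_card_sdiff (hAY A)
    rw [← Finset.sum_congr rfl h2]
    exact_mod_cast h1
  have hY : ∑ A ∈ I, codim d (Y A) = rho d I - ∑ A ∈ I, ((Y A).card - A.card : ℤ) := by
    rw [rho, ← Finset.sum_sub_distrib]
    exact Finset.sum_congr rfl fun A _ => by
      unfold codim
      ring
  have e1 : codim d (V.inf id) = (d : ℤ) + 1 - (V.inf id).card := rfl
  have e2 : codim d (I.inf id) = (d : ℤ) + 1 - (I.inf id).card := rfl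
  unfold Dd at hDI ⊢
  linarith

section Transfer

variable {α β : Type*} {A : Finset α} {B : Finset β}

/-- The supersets of `A` correspond to the supersets of `B` through a bijection of complements. -/
noncomputable def transfer (e : {x // x ∉ A} ≃ {y // y ∉ B}) (X : Finset α) : Finset β :=
  B ∪ ((X.subtype (· ∉ A)).map e.toEmbedding).map (Function.Embedding.subtype _)

lemma mem_transfer (e : {x // x ∉ A} ≃ {y // y ∉ B}) (X : Finset α) (y : β) :
    y ∈ transfer e X ↔ ∀ h : y ∉ B, (e.symm ⟨y, h⟩).1 ∈ X := by
  by_cases hy : y ∈ B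
  · simp [transfer, hy]
  · simp only [transfer, Finset.mem_union, hy, false_or, Finset.mem_map, Finset.mem_subtype,
      Function.Embedding.subtype_apply, Equiv.coe_toEmbedding, not_false_eq_true, forall_true_left]
    constructor
    · rintro ⟨_, ⟨x, hx, rfl⟩, rfl⟩
      simpa using hx
    · intro h
      exact ⟨_, ⟨_, h, rfl⟩, by simp⟩

lemma subset_transfer (e : {x // x ∉ A} ≃ {y // y ∉ B}) (X : Finset α) : B ⊆ transfer e X :=
  Finset.subset_union_left

lemma transfer_mono (e : {x // x ∉ A} ≃ {y // y ∉ B}) {X Y : Finset α} (h : X ⊆ Y) :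
    transfer e X ⊆ transfer e Y := fun y hy => by
  rw [mem_transfer] at hy ⊢
  exact fun h' => h (hy h')

lemma transfer_symm_transfer (e : {x // x ∉ A} ≃ {y // y ∉ B}) {X : Finset α} (h : A ⊆ X) :
    transfer e.symm (transfer e X) = X := by
  ext x
  simp only [mem_transfer, Equiv.symm_symm]
  by_cases hx : x ∈ A
  · simp [hx, h hx]
  · simp [hx, (e ⟨x, hx⟩).2]

lemma card_transfer (e : {x // x ∉ A} ≃ {y // y ∉ B}) {X : Finset α} (h : A ⊆ X) :
    (transfer e X).card + A.card = X.card + B.card := by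
  have hdisj : Disjoint B
      (((X.subtype (· ∉ A)).map e.toEmbedding).map (Function.Embedding.subtype _)) := by
    rw [Finset.disjoint_left]
    intro y hy hy'
    obtain ⟨z, -, rfl⟩ := Finset.mem_map.1 hy'
    exact z.2 hy
  have hsd : X.filter (· ∉ A) = X \ A := by
    ext x
    simp
  rw [transfer, Finset.card_union_of_disjoint hdisj, Finset.card_map, Finset.card_map,
    Finset.card_subtype, hsd]
  have := Finset.card_sdiff_add_card_eq_card h
  omega

end Transfer

section Shift

variable {l n n' : ℕ}

/-- Some index `i` with `f i ⊆ X`, if there is one. -/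
noncomputable def index [Nonempty (Fin l)] (f : Fin l → Finset (Fin n)) (X : Finset (Fin n)) :
    Fin l :=
  Classical.epsilon fun i => f i ⊆ X

/-- `X` has at most `d` elements and contains one of the `f i`. -/
def Above (d : ℕ) (f : Fin l → Finset (Fin n)) (X : Finset (Fin n)) : Prop :=
  X.card ≤ d ∧ ∃ i, f i ⊆ X

lemma above_of_le {d : ℕ} {f : Fin l → Finset (Fin n)} {S T : L n d}
    (hfT : T.val = Finset.univ.image f) (h : S ≤ T) :
    ∀ X ∈ S.val, Above d f X := by
  intro X hX
  obtain ⟨Y, hY, hYX⟩ := le_iff_s8.1 h X hX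
  rw [hfT] at hY
  obtain ⟨i, -, rfl⟩ := Finset.mem_image.1 hY
  exact ⟨S.mem.2 X hX, i, hYX⟩

/-- Replace the part `f i` of `X ⊇ f i` by `g i` and move the rest along the bijection `e i`. -/
noncomputable def shift [Nonempty (Fin l)] {f : Fin l → Finset (Fin n)}
    {g : Fin l → Finset (Fin n')} (e : ∀ i, {x // x ∉ f i} ≃ {y // y ∉ g i})
    (X : Finset (Fin n)) : Finset (Fin n') :=
  transfer (e (index f X)) X

variable [Nonempty (Fin l)] {d d' : ℕ} {f : Fin l → Finset (Fin n)} {g : Fin l → Finset (Fin n')}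
  (e : ∀ i, {x // x ∉ f i} ≃ {y // y ∉ g i})

lemma index_subset {X : Finset (Fin n)} (h : Above d f X) : f (index f X) ⊆ X :=
  Classical.epsilon_spec h.2

lemma index_eq (hf : Function.Injective f) (hT : memL n d (Finset.univ.image f))
    {X : Finset (Fin n)} (hX : X.card ≤ d) {i : Fin l} (hi : f i ⊆ X) : index f X = i :=
  hf (eq_of_subset_of_subset hT (by simp) (by simp)
    (index_subset (d := d) ⟨hX, i, hi⟩) hi hX)

lemma codim_shift (hc : ∀ i, codim d (f i) = codim d' (g i)) {X : Finset (Fin n)}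
    (h : Above d f X) : codim d' (shift e X) = codim d X := by
  have h1 := card_transfer (e (index f X)) (index_subset h)
  have h2 := hc (index f X)
  unfold codim at *
  unfold shift
  omega

lemma above_shift (hc : ∀ i, codim d (f i) = codim d' (g i)) {X : Finset (Fin n)}
    (h : Above d f X) : Above d' g (shift e X) := by
  refine ⟨?_, index f X, subset_transfer _ _⟩
  have h1 := codim_shift e hc h
  have h2 := h.1
  unfold codim at h1
  omega

lemma index_shift (hg : Function.Injective g) (hT' : memL n' d' (Finset.univ.image g))
    (hc : ∀ i, codim d (f i) = codim d' (g i)) {X : Finset (Fin n)} (h : Above d f X) :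
    index g (shift e X) = index f X :=
  index_eq hg hT' (above_shift e hc h).1 (subset_transfer _ _)

lemma shift_symm_shift (hg : Function.Injective g) (hT' : memL n' d' (Finset.univ.image g))
    (hc : ∀ i, codim d (f i) = codim d' (g i)) {X : Finset (Fin n)} (h : Above d f X) :
    shift (fun i => (e i).symm) (shift e X) = X := by
  rw [shift, index_shift e hg hT' hc h]
  exact transfer_symm_transfer _ (index_subset h)

lemma shift_mono (hf : Function.Injective f) (hT : memL n d (Finset.univ.image f))
    {X Y : Finset (Fin n)} (hX : Above d f X) (hY : Y.card ≤ d) (h : X ⊆ Y) :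
    shift e X ⊆ shift e Y := by
  rw [shift, shift, index_eq hf hT hY ((index_subset hX).trans h)]
  exact transfer_mono _ h

lemma memL_image_shift (hg : Function.Injective g) (hT' : memL n' d' (Finset.univ.image g))
    (hc : ∀ i, codim d (f i) = codim d' (g i)) {S : Coll n} (hS : memL n d S)
    (hSf : ∀ X ∈ S, Above d f X) : memL n' d' (S.image (shift e)) := by
  have hinv : ∀ X ∈ S, shift (fun i => (e i).symm) (shift e X) = X := fun X hX =>
    shift_symm_shift e hg hT' hc (hSf X hX)
  have habove : ∀ Y ∈ S.image (shift e), Above d' g Y := by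
    intro Y hY
    obtain ⟨X, hX, rfl⟩ := Finset.mem_image.1 hY
    exact above_shift e hc (hSf X hX)
  refine memL_of_fibers hT' (fun Y => g (index g Y)) (fun _ _ => by simp)
    (fun Y hY => index_subset (habove Y hY)) (fun Y hY => (habove Y hY).1) ?_
  intro A U hU hA hUcard
  obtain ⟨V, hVS, rfl⟩ := Finset.subset_image_iff.1 hU
  have hVS' : V ⊆ S := by exact_mod_cast hVS
  have hinj : Set.InjOn (shift e) V := fun X hX Y hY hXY => by
    rw [← hinv X (hVS hX), hXY, hinv Y (hVS hY)]
  rw [Finset.card_image_of_injOn hinj] at hUcard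
  obtain ⟨X₀, hX₀⟩ : V.Nonempty := Finset.card_pos.1 (by omega)
  have hindex : ∀ X ∈ V, index f X = index f X₀ := by
    have h1 : ∀ X ∈ V, g (index f X) = A := fun X hX => by
      rw [← index_shift e hg hT' hc (hSf X (hVS hX))]
      exact hA _ (Finset.mem_image_of_mem _ hX)
    exact fun X hX => hg ((h1 X hX).trans (h1 X₀ hX₀).symm)
  have hrho : rho d' (V.image (shift e)) = rho d V := by
    rw [rho, Finset.sum_image hinj]
    exact Finset.sum_congr rfl fun X hX => codim_shift e hc (hSf X (hVS hX))
  have hW : Above d f (V.inf id) := by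
    refine ⟨(Finset.card_le_card (Finset.inf_le (f := id) hX₀)).trans (hSf X₀ (hVS hX₀)).1,
      index f X₀, Finset.le_inf fun X hX => ?_⟩
    rw [← hindex X hX]
    exact index_subset (hSf X (hVS hX))
  have hW' : Above d' g ((V.image (shift e)).inf id) := by
    refine ⟨(Finset.card_le_card (Finset.inf_le (f := id) (Finset.mem_image_of_mem _ hX₀))).trans
      (above_shift e hc (hSf X₀ (hVS hX₀))).1, index f X₀, Finset.le_inf fun Y hY => ?_⟩
    obtain ⟨X, hX, rfl⟩ := Finset.mem_image.1 hY
    rw [← hindex X hX]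
    exact subset_transfer _ _
  have hc' : ∀ i, codim d' (g i) = codim d (f i) := fun i => (hc i).symm
  have hcodim : codim d (V.inf id) ≤ codim d' ((V.image (shift e)).inf id) := by
    rw [← codim_shift (fun i => (e i).symm) hc' hW']
    refine codim_anti d (Finset.le_inf fun X hX => ?_)
    rw [id, ← hinv X (hVS hX)]
    exact shift_mono (fun i => (e i).symm) hg hT' hW' (above_shift e hc (hSf X (hVS hX))).1
      (Finset.inf_le (f := id) (Finset.mem_image_of_mem _ hX))
  have hD := hS.1 V hVS' hUcard
  unfold Dd at hD ⊢
  omega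

/-- The map of lower intervals `[∅, T] → [∅, T']` induced by `shift`. -/
noncomputable def shiftIic {T : L n d} {T' : L n' d'}
    (hg : Function.Injective g) (hfT : T.val = Finset.univ.image f)
    (hgT : T'.val = Finset.univ.image g) (hc : ∀ i, codim d (f i) = codim d' (g i))
    (S : Set.Iic T) : Set.Iic T' :=
  ⟨⟨S.1.val.image (shift e), memL_image_shift e hg (hgT ▸ T'.mem) hc S.1.mem
      (above_of_le hfT S.2)⟩, le_iff_s8.2 fun Y hY => by
    obtain ⟨X, hX, rfl⟩ := Finset.mem_image.1 hY
    exact ⟨g (index f X), by simp [hgT], subset_transfer _ _⟩⟩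

lemma shiftIic_shiftIic {T : L n d} {T' : L n' d'} (hf : Function.Injective f)
    (hg : Function.Injective g) (hfT : T.val = Finset.univ.image f)
    (hgT : T'.val = Finset.univ.image g) (hc : ∀ i, codim d (f i) = codim d' (g i))
    (S : Set.Iic T) :
    shiftIic (fun i => (e i).symm) hf hgT hfT (fun i => (hc i).symm)
      (shiftIic e hg hfT hgT hc S) = S := by
  obtain ⟨⟨S, hS⟩, hST⟩ := S
  simp only [shiftIic, Subtype.mk.injEq, L.mk.injEq, Finset.image_image]
  refine (Finset.image_congr fun X hX => ?_).trans Finset.image_id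
  exact shift_symm_shift e hg (hgT ▸ T'.mem) hc (above_of_le hfT hST X hX)

lemma shiftIic_mono {T : L n d} {T' : L n' d'} (hf : Function.Injective f)
    (hg : Function.Injective g) (hfT : T.val = Finset.univ.image f)
    (hgT : T'.val = Finset.univ.image g) (hc : ∀ i, codim d (f i) = codim d' (g i)) :
    Monotone (shiftIic e hg hfT hgT hc) := by
  intro S S' h
  refine le_iff_s8.2 fun Y hY => ?_
  obtain ⟨X, hX, rfl⟩ := Finset.mem_image.1 hY
  obtain ⟨Z, hZ, hZX⟩ := le_iff_s8.1 h X hX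
  exact ⟨shift e Z, Finset.mem_image_of_mem _ hZ, shift_mono e hf (hfT ▸ T.mem)
    (above_of_le hfT S'.2 Z hZ) (S.1.mem.2 X hX) hZX⟩

/-- The lower intervals of `T` and `T'` are isomorphic. -/
noncomputable def iicOrderIso {T : L n d} {T' : L n' d'} (hf : Function.Injective f)
    (hg : Function.Injective g) (hfT : T.val = Finset.univ.image f)
    (hgT : T'.val = Finset.univ.image g) (hc : ∀ i, codim d (f i) = codim d' (g i)) :
    Set.Iic T ≃o Set.Iic T' :=
  OrderIso.ofHomInv (⟨shiftIic e hg hfT hgT hc, shiftIic_mono e hf hg hfT hgT hc⟩ : _ →o _)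
    (⟨shiftIic (fun i => (e i).symm) hf hgT hfT (fun i => (hc i).symm),
      shiftIic_mono _ hg hf hgT hfT _⟩ : _ →o _)
    (by
      ext1
      funext S
      exact shiftIic_shiftIic (fun i => (e i).symm) hg hf hgT hfT (fun i => (hc i).symm) S)
    (by
      ext1
      funext S
      exact shiftIic_shiftIic e hf hg hfT hgT hc S)

end Shift

/-- The Möbius function from the bottom element up to `t` is determined by the isomorphism class
of the lower interval of `t`. -/
lemma mobius_eq_of_orderIso {P Q : Type*} [PartialOrder P] [Fintype P] [PartialOrder Q] [Fintype Q]
    {a : P} {b : Q} (ha : ∀ x, a ≤ x) (hb : ∀ y, b ≤ y) {t : P} {t' : Q}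
    (φ : Set.Iic t ≃o Set.Iic t') (μ : P → ℤ) (ν : Q → ℤ) (hμ : μ a = 1) (hν : ν b = 1)
    (hμs : ∀ x, a < x → ∑ z ∈ Finset.univ.filter (fun z => a ≤ z ∧ z ≤ x), μ z = 0)
    (hνs : ∀ y, b < y → ∑ z ∈ Finset.univ.filter (fun z => b ≤ z ∧ z ≤ y), ν z = 0) :
    μ t = ν t' := by
  have hφa : (φ ⟨a, ha t⟩).1 = b := by
    refine le_antisymm ?_ (hb _)
    have h : (⟨a, ha t⟩ : Set.Iic t) ≤ φ.symm ⟨b, hb t'⟩ := ha _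
    exact (φ.le_symm_apply.1 h)
  have key : ∀ x (hx : x ≤ t), μ x = ν (φ ⟨x, hx⟩).1 := by
    intro x
    induction x using WellFoundedLT.induction with
    | ind x ih =>
      intro hx
      rcases (ha x).eq_or_lt with rfl | hax
      · rw [hφa, hμ, hν]
      have hby : b < (φ ⟨x, hx⟩).1 := by
        rw [← hφa]
        exact φ.strictMono (show (⟨a, ha t⟩ : Set.Iic t) < ⟨x, hx⟩ from hax)
      have h1 := hμs x hax
      have h2 := hνs _ hby
      rw [← Finset.add_sum_erase _ _ (by simp [ha] : x ∈ _)] at h1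
      rw [← Finset.add_sum_erase _ _ (by simp [hb] : (φ ⟨x, hx⟩).1 ∈ _)] at h2
      have h3 : ∑ z ∈ (Finset.univ.filter (fun z => a ≤ z ∧ z ≤ x)).erase x, μ z =
          ∑ z ∈ (Finset.univ.filter (fun z => b ≤ z ∧ z ≤ (φ ⟨x, hx⟩).1)).erase (φ ⟨x, hx⟩).1,
            ν z := by
        have hlt : ∀ z ∈ (Finset.univ.filter (fun z => a ≤ z ∧ z ≤ x)).erase x, z < x := by
          intro z hz
          simp only [Finset.mem_erase, Finset.mem_filter] at hz
          exact lt_of_le_of_ne hz.2.2.2 hz.1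
        refine Finset.sum_bij (fun z hz => (φ ⟨z, (hlt z hz).le.trans hx⟩).1) ?_ ?_ ?_ ?_
        · intro z hz
          have h : φ ⟨z, (hlt z hz).le.trans hx⟩ < φ ⟨x, hx⟩ := φ.strictMono (hlt z hz)
          simp only [Finset.mem_erase, Finset.mem_filter, Finset.mem_univ, true_and]
          exact ⟨(Subtype.coe_lt_coe.2 h).ne, hb _, (Subtype.coe_le_coe.2 h.le)⟩
        · intro z hz w hw h
          exact congrArg Subtype.val (φ.injective (Subtype.ext h))
        · intro y hy
          simp only [Finset.mem_erase, Finset.mem_filter, Finset.mem_univ, true_and] at hy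
          have hyt : y ≤ t' := hy.2.2.trans (φ ⟨x, hx⟩).2
          have h : φ.symm ⟨y, hyt⟩ < ⟨x, hx⟩ := by
            rw [φ.symm_apply_lt]
            exact lt_of_le_of_ne hy.2.2 fun h => hy.1 (congrArg Subtype.val h)
          refine ⟨(φ.symm ⟨y, hyt⟩).1, ?_, congrArg Subtype.val (φ.apply_symm_apply ⟨y, hyt⟩)⟩
          simp only [Finset.mem_erase, Finset.mem_filter, Finset.mem_univ, true_and]
          exact ⟨(Subtype.coe_lt_coe.2 h).ne, ha _, (Subtype.coe_le_coe.2 h.le)⟩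
        · intro z hz
          exact ih z (hlt z hz) _
      linarith
  have htop : (φ ⟨t, le_rfl⟩).1 = t' := by
    refine le_antisymm (φ ⟨t, le_rfl⟩).2 ?_
    have h : φ.symm ⟨t', le_rfl⟩ ≤ (⟨t, le_rfl⟩ : Set.Iic t) := (φ.symm _).2
    exact φ.symm_apply_le.1 h
  rw [key t le_rfl, htop]

end L

/-- Let `n − d = n' − d'`, and let `T = {T_1,…,T_l} ∈ L(n,d)` and
`T' = {T'_1,…,T'_l} ∈ L(n',d')` have the same number `l ≥ 1` of members with
`codim_d(T_i) = codim_{d'}(T'_i)` for each `i`. Then `μ_{n,d}(T) = μ_{n',d'}(T')`,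
where `μ` denotes the Möbius function of each poset. -/
theorem mobius_depends_only_on_type (n d n' d' : ℕ) (hnd : d < n) (hnd' : d' < n')
    (hshift : n - d = n' - d') (l : ℕ) (hl : 1 ≤ l)
    (f : Fin l → Finset (Fin n)) (g : Fin l → Finset (Fin n'))
    (hf : Function.Injective f) (hg : Function.Injective g)
    (T : L n d) (T' : L n' d')
    (hfT : T.val = Finset.univ.image f) (hgT : T'.val = Finset.univ.image g)
    (hcodim : ∀ i, codim d (f i) = codim d' (g i))
    (μ : (m e : ℕ) → L m e → L m e → ℤ)
    (hrefl : ∀ m e (A : L m e), μ m e A A = 1)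
    (hrec : ∀ m e (A B : L m e), A < B →
      ∑ S ∈ Finset.univ.filter (fun S : L m e => A ≤ S ∧ S ≤ B), μ m e A S = 0) :
    μ n d (Lbot n d) T = μ n' d' (Lbot n' d') T' := by
  have : Nonempty (Fin l) := ⟨⟨0, hl⟩⟩
  have hcard : ∀ i, Fintype.card {x // x ∉ f i} = Fintype.card {y // y ∉ g i} := by
    intro i
    have h1 := hcodim i
    have h2 := (f i).card_le_univ
    have h3 := (g i).card_le_univ
    simp only [Fintype.card_fin] at h2 h3
    unfold codim at h1
    simp only [Fintype.card_subtype_compl, Fintype.card_fin, Fintype.card_coe]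
    omega
  let e : ∀ i, {x // x ∉ f i} ≃ {y // y ∉ g i} := fun i => Fintype.equivOfCardEq (hcard i)
  exact L.mobius_eq_of_orderIso L.Lbot_le L.Lbot_le (L.iicOrderIso e hf hg hfT hgT hcodim) _ _
    (hrefl _ _ _) (hrefl _ _ _) (hrec n d _) (hrec n' d' _)
end

section
/- Let d ≥ 0, n > d, and let γ = (γ_1,…,γ_l) be a partition with l ≥ 1 parts, all parts γ_i ≥ 1. Let N(n,d;γ) be the set of functions ν from the power set of {1,…,l} to the nonnegative integers satisfying: (i) Σ_{I : i ∈ I} ν(I) = d + 1 − γ_i for every i = 1,…,l; (ii) Σ_{I' : I ⊆ I'} ν(I') < d + 1 − Σ_{i ∈ I} γ_i for every I ⊆ {1,…,l} with |I| ≥ 2; (iii) Σ_{I ⊆ {1,…,l}} ν(I) = n. Then λ_{n,d}(γ) · ∏_{k ≥ 1} m_k(γ)! = Σ_{ν ∈ N(n,d;γ)} n! / ∏_{I ⊆ {1,…,l}} ν(I)!, where m_k(γ) = |{i : γ_i = k}| is the multiplicity of k in γ and each summand is the multinomial coefficient of n with respect to the values (ν(I))_{I ⊆ {1,…,l}}.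 -/
attribute [local instance] Classical.propDecidable

/-- Two functions on finite types with fibres of equal sizes differ by a bijection of the
domains. -/
theorem exists_equiv_comp_eq_of_card_fiber_eq {α β ι : Type*} [Fintype α] [Fintype β]
    (f : α → ι) (g : β → ι)
    (h : ∀ i, Fintype.card {a // f a = i} = Fintype.card {b // g b = i}) :
    ∃ e : α ≃ β, g ∘ e = f := by
  refine ⟨(Equiv.sigmaFiberEquiv f).symm.trans
    ((Equiv.sigmaCongrRight fun i => Fintype.equivOfCardEq (h i)).trans
      (Equiv.sigmaFiberEquiv g)), ?_⟩
  funext a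
  exact ((Fintype.equivOfCardEq (h (f a))) ⟨a, rfl⟩).2

theorem exists_equiv_comp_eq_of_map_univ_eq {α β ι : Type*} [Fintype α] [Fintype β]
    (f : α → ι) (g : β → ι)
    (h : Multiset.map f Finset.univ.val = Multiset.map g Finset.univ.val) :
    ∃ e : α ≃ β, g ∘ e = f := by
  refine exists_equiv_comp_eq_of_card_fiber_eq f g fun i => ?_
  have := congrArg (Multiset.count i) h
  rw [Multiset.count_map, Multiset.count_map] at this
  rw [Fintype.card_subtype, Fintype.card_subtype, Finset.card_def, Finset.card_def,
    Finset.filter_val, Finset.filter_val]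
  simpa only [eq_comm] using this

/-- The number of functions with prescribed fibre sizes is a multinomial coefficient. -/
theorem card_filter_card_fiber_eq {α ι : Type*} [Fintype α] [Fintype ι] [DecidableEq ι] (ν : ι → ℕ)
    (hν : ∑ i, ν i = Fintype.card α) :
    (Finset.univ.filter fun f : α → ι => ∀ i, (Finset.univ.filter fun a => f a = i).card = ν i).card
      = (Fintype.card α).factorial / ∏ i, (ν i).factorial := by
  obtain ⟨e⟩ : Nonempty (α ≃ Σ i, Fin (ν i)) := by
    rw [← Fintype.card_eq]
    simp [hν]
  have key : ∀ f : α → ι, (∀ i, (Finset.univ.filter fun a => f a = i).card = ν i) →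
      (Finset.univ.filter fun σ : Equiv.Perm α => (fun a => (e a).1) ∘ σ = f).card
        = ∏ i, (ν i).factorial := by
    intro f hf
    have hcard (i : ι) : Fintype.card {a // (e a).1 = i} = ν i := by
      rw [Fintype.card_congr ((e.subtypeEquiv fun a => Iff.rfl).trans
        (Equiv.sigmaSubtype (β := fun i => Fin (ν i)) i)), Fintype.card_fin]
    obtain ⟨τ, hτ⟩ := exists_equiv_comp_eq_of_card_fiber_eq f (fun a => (e a).1) fun i => by
      rw [Fintype.card_subtype]
      convert (hf i).trans (hcard i).symm
    have hs := DomMulAct.stabilizer_card (fun a => (e a).1)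
    simp only [hcard] at hs
    rw [← hs, Fintype.card_subtype]
    refine Finset.card_bij (fun σ _ => τ.symm.trans σ) ?_ ?_ ?_
    · intro σ hσ
      simp only [Finset.mem_filter, Finset.mem_univ, true_and] at hσ ⊢
      funext a
      have h1 := congrFun hσ (τ.symm a)
      have h2 := congrFun hτ (τ.symm a)
      simp only [Function.comp_apply, Equiv.apply_symm_apply, Equiv.trans_apply] at h1 h2 ⊢
      rw [h1, h2]
    · intro σ _ σ' _ h
      ext a
      simpa using congrArg (fun ρ : Equiv.Perm α => ρ (τ a)) h
    · intro σ hσ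
      simp only [Finset.mem_filter, Finset.mem_univ, true_and] at hσ
      refine ⟨τ.trans σ, ?_, by ext; simp⟩
      simp only [Finset.mem_filter, Finset.mem_univ, true_and]
      funext a
      have h1 := congrFun hσ (τ a)
      have h2 := congrFun hτ a
      simp only [Function.comp_apply, Equiv.trans_apply] at h1 h2 ⊢
      rw [h1, h2]
  have hfib := Finset.card_eq_sum_card_fiberwise (s := (Finset.univ : Finset (Equiv.Perm α)))
    (t := Finset.univ.filter fun f : α → ι =>
      ∀ i, (Finset.univ.filter fun a => f a = i).card = ν i)
    (f := fun σ : Equiv.Perm α => (fun a => (e a).1) ∘ σ) (by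
      intro σ _
      simp only [Finset.coe_filter, Finset.mem_univ, true_and, Set.mem_ofPred_eq,
        Function.comp_apply]
      intro i
      rw [← Fintype.card_subtype, ← Fintype.card_fin (ν i)]
      exact Fintype.card_congr (((σ.trans e).subtypeEquiv fun a => Iff.rfl).trans
          (Equiv.sigmaSubtype (β := fun i => Fin (ν i)) i)))
  rw [Finset.card_univ, Fintype.card_perm, Finset.sum_congr rfl fun f hf =>
    key f (Finset.mem_filter.1 hf).2, Finset.sum_const, smul_eq_mul] at hfib
  rw [hfib, Nat.mul_div_cancel _ (Finset.prod_pos fun i _ => Nat.factorial_pos _)]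

/-- The families `h_1, …, h_l` of subsets of `{1,…,n}` of codimensions `g_1, …, g_l` which
enumerate an element of `L(n,d)`. -/
def IsLabelling (n d : ℕ) {l : ℕ} (g : Fin l → ℕ) (h : Fin l → Finset (Fin n)) : Prop :=
  (∀ i, ((h i).card : ℤ) = (d : ℤ) + 1 - g i) ∧
    ∀ I : Finset (Fin l), 2 ≤ I.card → ((I.inf h).card : ℤ) < (d : ℤ) + 1 - ∑ i ∈ I, (g i : ℤ)

theorem IsLabelling.injective {n d l : ℕ} {g : Fin l → ℕ} (hpos : ∀ i, 1 ≤ g i)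
    {h : Fin l → Finset (Fin n)} (hh : IsLabelling n d g h) : Function.Injective h := by
  intro i j hij
  by_contra hne
  have h2 := hh.2 {i, j} (Finset.card_pair hne).ge
  rw [Finset.sum_pair hne, Finset.inf_insert, Finset.inf_singleton, ← hij, inf_idem,
    hh.1 i] at h2
  have := hpos j
  omega

theorem isLabelling_iff {n d l : ℕ} {g : Fin l → ℕ} (hpos : ∀ i, 1 ≤ g i)
    {h : Fin l → Finset (Fin n)} (hinj : Function.Injective h) :
    IsLabelling n d g h ↔
      memL n d (Finset.univ.image h) ∧ ∀ i, d + 1 - (h i).card = g i := by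
  have hDd (hc : ∀ i, ((h i).card : ℤ) = (d : ℤ) + 1 - g i) (I : Finset (Fin l)) :
      0 < Dd d (I.image h) ↔ ((I.inf h).card : ℤ) < (d : ℤ) + 1 - ∑ i ∈ I, (g i : ℤ) := by
    have hrho : rho d (I.image h) = ∑ i ∈ I, (g i : ℤ) := by
      rw [rho, Finset.sum_image hinj.injOn]
      refine Finset.sum_congr rfl fun i _ => ?_
      rw [codim, hc]
      ring
    rw [Dd, hrho, codim, Finset.inf_image, Function.id_comp]
    constructor <;> intro <;> linarith
  constructor
  · rintro ⟨hc, hI⟩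
    refine ⟨⟨fun T' hT' h2 => ?_, fun X hX => ?_⟩, fun i => ?_⟩
    · obtain ⟨I, -, rfl⟩ := Finset.subset_image_iff.1 hT'
      rw [Finset.card_image_of_injective _ hinj] at h2
      exact (hDd hc I).2 (hI I h2)
    · obtain ⟨i, -, rfl⟩ := Finset.mem_image.1 hX
      have := hc i
      have := hpos i
      omega
    · have := hc i
      omega
  · rintro ⟨⟨hT, hle⟩, hg⟩
    have hc (i : Fin l) : ((h i).card : ℤ) = (d : ℤ) + 1 - g i := by
      have := hle (h i) (Finset.mem_image_of_mem h (Finset.mem_univ i))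
      have := hg i
      omega
    refine ⟨hc, fun I h2 => (hDd hc I).1
      (hT _ (Finset.image_subset_image (Finset.subset_univ I)) ?_)⟩
    rwa [Finset.card_image_of_injective _ hinj]

theorem lam_eq_card_filter_coll (n d : ℕ) (γ : Multiset ℕ) :
    lam n d γ = (Finset.univ.filter fun T : Coll n =>
      memL n d T ∧ T.val.map (fun X => d + 1 - X.card) = γ).card := by
  refine Finset.card_bij (fun T _ => T.val) ?_ ?_ ?_
  · intro T hT
    exact Finset.mem_filter.2 ⟨Finset.mem_univ _, T.mem, (Finset.mem_filter.1 hT).2⟩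
  · rintro ⟨S, _⟩ _ ⟨T, _⟩ _ h
    cases h
    rfl
  · intro T hT
    obtain ⟨-, hT, hγ⟩ := Finset.mem_filter.1 hT
    exact ⟨⟨T, hT⟩, Finset.mem_filter.2 ⟨Finset.mem_univ _, hγ⟩, rfl⟩

theorem card_perm_comp_eq {l : ℕ} (g : Fin l → ℕ) :
    (Finset.univ.filter fun σ : Equiv.Perm (Fin l) => g ∘ σ = g).card =
      ∏ k ∈ (Multiset.map g Finset.univ.val).toFinset,
        Nat.factorial ((Multiset.map g Finset.univ.val).count k) := by
  rw [← Fintype.card_subtype, DomMulAct.stabilizer_card']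
  refine Finset.prod_congr rfl fun k _ => ?_
  rw [Multiset.count_map, Fintype.card_subtype, Finset.card_def, Finset.filter_val]
  simp only [eq_comm]

theorem image_univ_val_eq_map {α β : Type*} [Fintype α] [DecidableEq β] {h : α → β}
    (hinj : Function.Injective h) :
    (Finset.univ.image h).val = Multiset.map h Finset.univ.val :=
  Finset.image_val_of_injOn hinj.injOn

/-- Each element of `L(n,d)` whose type is given by `g` is enumerated by as many labellings as
there are permutations preserving `g`. -/
theorem card_filter_isLabelling_image_eq {n d l : ℕ} {g : Fin l → ℕ} (hpos : ∀ i, 1 ≤ g i)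
    {T : Coll n} (hT : memL n d T)
    (htype : T.val.map (fun X => d + 1 - X.card) = Multiset.map g Finset.univ.val) :
    (Finset.univ.filter fun h : Fin l → Finset (Fin n) =>
      IsLabelling n d g h ∧ Finset.univ.image h = T).card =
    (Finset.univ.filter fun σ : Equiv.Perm (Fin l) => g ∘ σ = g).card := by
  obtain ⟨e, he⟩ := exists_equiv_comp_eq_of_map_univ_eq g
    (fun X : T => d + 1 - (X : Finset (Fin n)).card) (by
      rw [← htype, Finset.univ_eq_attach, Finset.attach_val]
      exact (Multiset.attach_map_val' T.val fun X => d + 1 - X.card).symm)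
  have hinj : Function.Injective fun i => (e i : Finset (Fin n)) :=
    Subtype.val_injective.comp e.injective
  have hg (i : Fin l) : d + 1 - (e i : Finset (Fin n)).card = g i := congrFun he i
  have himage : Finset.univ.image (fun i => (e i : Finset (Fin n))) = T := by
    ext X
    simp only [Finset.mem_image, Finset.mem_univ, true_and]
    exact ⟨fun ⟨i, hi⟩ => hi ▸ (e i).2, fun hX => ⟨e.symm ⟨X, hX⟩, by simp⟩⟩
  symm
  refine Finset.card_bij (fun σ _ i => (e (σ i) : Finset (Fin n))) ?_ ?_ ?_
  · intro σ hσ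
    have hσ := (Finset.mem_filter.1 hσ).2
    have himage' : Finset.univ.image (fun i => (e (σ i) : Finset (Fin n))) = T := by
      refine Eq.trans ?_ himage
      ext X
      simp only [Finset.mem_image, Finset.mem_univ, true_and]
      exact (σ.surjective.exists (p := fun i => (e i : Finset (Fin n)) = X)).symm
    refine Finset.mem_filter.2 ⟨Finset.mem_univ _, ?_, himage'⟩
    refine (isLabelling_iff hpos (hinj.comp σ.injective)).2 ⟨?_, fun i => ?_⟩
    · exact himage'.symm ▸ hT
    · exact (hg (σ i)).trans (congrFun hσ i)
  · intro σ _ τ _ h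
    ext i
    exact congrArg Fin.val (hinj (congrFun h i))
  · intro h hh
    obtain ⟨-, hh, hhT⟩ := Finset.mem_filter.1 hh
    have hhinj := hh.injective hpos
    obtain ⟨σ, hσ⟩ := exists_equiv_comp_eq_of_map_univ_eq h (fun i => (e i : Finset (Fin n))) (by
      rw [← image_univ_val_eq_map hinj, ← image_univ_val_eq_map hhinj, hhT, himage])
    refine ⟨σ, Finset.mem_filter.2 ⟨Finset.mem_univ _, ?_⟩, hσ⟩
    funext i
    rw [← ((isLabelling_iff hpos hhinj).1 hh).2 i, ← hσ]
    exact (hg (σ i)).symm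

theorem lam_mul_prod_eq_card {n d l : ℕ} {g : Fin l → ℕ} (hpos : ∀ i, 1 ≤ g i) :
    lam n d (Multiset.map g Finset.univ.val) *
      ∏ k ∈ (Multiset.map g Finset.univ.val).toFinset,
        Nat.factorial ((Multiset.map g Finset.univ.val).count k)
    = (Finset.univ.filter fun h : Fin l → Finset (Fin n) => IsLabelling n d g h).card := by
  rw [← card_perm_comp_eq, lam_eq_card_filter_coll, Finset.card_eq_sum_card_fiberwise
    (f := fun h : Fin l → Finset (Fin n) => Finset.univ.image h)
    (t := Finset.univ.filter fun T : Coll n => memL n d T ∧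
      T.val.map (fun X => d + 1 - X.card) = Multiset.map g Finset.univ.val)]
  · rw [← smul_eq_mul, ← Finset.sum_const]
    refine Finset.sum_congr rfl fun T hT => ?_
    obtain ⟨-, hT, htype⟩ := Finset.mem_filter.1 hT
    rw [Finset.filter_filter, card_filter_isLabelling_image_eq hpos hT htype]
  · intro h hh
    have hh := (Finset.mem_filter.1 hh).2
    have hinj := hh.injective hpos
    obtain ⟨hL, hg⟩ := (isLabelling_iff hpos hinj).1 hh
    refine Finset.mem_coe.2 (Finset.mem_filter.2 ⟨Finset.mem_univ _, hL, ?_⟩)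
    refine (congrArg _ (image_univ_val_eq_map hinj)).trans ?_
    rw [Multiset.map_map]
    exact Multiset.map_congr rfl fun i _ => hg i

/-- The set of functions on subsets of `{1,…,l}` that arise by counting, for each `I`, the points
lying in exactly those members of a labelling which are indexed by `I`. -/
def regionProfiles (n d : ℕ) {l : ℕ} (g : Fin l → ℕ) : Set (Finset (Fin l) → ℕ) :=
  {ν | (∀ i : Fin l,
          ((∑ I ∈ Finset.univ.filter (fun I : Finset (Fin l) => i ∈ I), ν I : ℕ) : ℤ)
            = (d : ℤ) + 1 - (g i : ℤ)) ∧
        (∀ I : Finset (Fin l), 2 ≤ I.card →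
          ((∑ I' ∈ Finset.univ.filter (fun I' : Finset (Fin l) => I ⊆ I'), ν I' : ℕ) : ℤ)
            < (d : ℤ) + 1 - ∑ i ∈ I, (g i : ℤ)) ∧
        (∑ I : Finset (Fin l), ν I = n)}

theorem finite_regionProfiles (n d : ℕ) {l : ℕ} (g : Fin l → ℕ) :
    (regionProfiles n d g).Finite := by
  refine (Set.finite_Iic (fun _ : Finset (Fin l) => n)).subset fun ν hν I => ?_
  rw [← hν.2.2]
  exact Finset.single_le_sum (f := ν) (fun _ _ => Nat.zero_le _) (Finset.mem_univ I)

/-- Transposition of an incidence relation given by a family of sets. -/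
def transposeEquiv (n l : ℕ) : (Fin n → Finset (Fin l)) ≃ (Fin l → Finset (Fin n)) where
  toFun f i := Finset.univ.filter fun a => i ∈ f a
  invFun h a := Finset.univ.filter fun i => a ∈ h i
  left_inv f := by
    funext a
    ext i
    simp
  right_inv h := by
    funext i
    ext a
    simp

theorem sum_filter_card_fiber_eq {α ι : Type*} [Fintype α] [Fintype ι] [DecidableEq ι]
    (f : α → ι) (p : ι → Prop) [DecidablePred p] :
    ∑ i ∈ Finset.univ.filter p, (Finset.univ.filter fun a => f a = i).card =
      (Finset.univ.filter fun a => p (f a)).card := by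
  rw [Finset.card_eq_sum_card_fiberwise (f := f) (t := Finset.univ.filter p)]
  · refine Finset.sum_congr rfl fun i hi => ?_
    rw [Finset.filter_filter]
    congr 1
    refine Finset.filter_congr fun a _ => ?_
    constructor
    · rintro rfl
      exact ⟨(Finset.mem_filter.1 hi).2, rfl⟩
    · exact And.right
  · intro a ha
    simpa using ha

theorem inf_transposeEquiv {n l : ℕ} (f : Fin n → Finset (Fin l)) (I : Finset (Fin l)) :
    I.inf (transposeEquiv n l f) = Finset.univ.filter fun a => I ⊆ f a := by
  ext a
  simp [Finset.mem_inf, transposeEquiv, Finset.subset_iff]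

theorem card_fiber_mem_regionProfiles_iff {n d l : ℕ} {g : Fin l → ℕ}
    (f : Fin n → Finset (Fin l)) :
    (fun I => (Finset.univ.filter fun a => f a = I).card) ∈ regionProfiles n d g ↔
      IsLabelling n d g (transposeEquiv n l f) := by
  have htotal : ∑ I, (Finset.univ.filter fun a => f a = I).card = n := by
    simpa using (Finset.card_eq_sum_card_fiberwise (f := f) (s := Finset.univ)
      (t := Finset.univ) (by simp)).symm
  simp only [regionProfiles, IsLabelling, Set.mem_ofPred_eq, htotal, and_true,
    sum_filter_card_fiber_eq, inf_transposeEquiv]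
  rfl

/-- For a partition `γ = (γ_1,…,γ_l)` with `l ≥ 1` positive parts,
`λ_{n,d}(γ) · ∏_{k ≥ 1} m_k(γ)! = Σ_{ν ∈ N(n,d;γ)} n! / ∏_{I ⊆ {1,…,l}} ν(I)!`,
where `N(n,d;γ)` is the set of functions `ν` from the power set of `{1,…,l}` to
the nonnegative integers such that (i) `Σ_{I : i ∈ I} ν(I) = d + 1 − γ_i` for
every `i`, (ii) `Σ_{I' : I ⊆ I'} ν(I') < d + 1 − Σ_{i ∈ I} γ_i` for every `I`
with `|I| ≥ 2`, and (iii) `Σ_I ν(I) = n`; `m_k(γ)` is the multiplicity of `k`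
in `γ`, and each summand is the multinomial coefficient of `n` with respect to
the values of `ν`. -/
theorem lam_eq_sum_multinomial (n d : ℕ) (hnd : d < n) (l : ℕ) (hl : 1 ≤ l)
    (g : Fin l → ℕ) (hanti : Antitone g) (hpos : ∀ i, 1 ≤ g i) :
    lam n d (Multiset.map g Finset.univ.val) *
      ∏ k ∈ (Multiset.map g Finset.univ.val).toFinset,
        Nat.factorial ((Multiset.map g Finset.univ.val).count k)
    = ∑ᶠ ν ∈ {ν : Finset (Fin l) → ℕ |
        (∀ i : Fin l,
          ((∑ I ∈ Finset.univ.filter (fun I : Finset (Fin l) => i ∈ I), ν I : ℕ) : ℤ)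
            = (d : ℤ) + 1 - (g i : ℤ)) ∧
        (∀ I : Finset (Fin l), 2 ≤ I.card →
          ((∑ I' ∈ Finset.univ.filter (fun I' : Finset (Fin l) => I ⊆ I'), ν I' : ℕ) : ℤ)
            < (d : ℤ) + 1 - ∑ i ∈ I, (g i : ℤ)) ∧
        (∑ I : Finset (Fin l), ν I = n)},
      Nat.factorial n / ∏ I : Finset (Fin l), Nat.factorial (ν I) := by
  rw [lam_mul_prod_eq_card hpos]
  change _ = ∑ᶠ ν ∈ regionProfiles n d g, _
  rw [finsum_mem_eq_finite_toFinset_sum _ (finite_regionProfiles n d g)]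
  trans (Finset.univ.filter fun f : Fin n → Finset (Fin l) =>
    IsLabelling n d g (transposeEquiv n l f)).card
  · refine (Finset.card_equiv (transposeEquiv n l) fun f => ?_).symm
    simp
  · rw [Finset.card_eq_sum_card_fiberwise
      (f := fun f : Fin n → Finset (Fin l) =>
        fun I => (Finset.univ.filter fun a => f a = I).card)
      (t := (finite_regionProfiles n d g).toFinset)]
    · refine Finset.sum_congr rfl fun ν hν => ?_
      rw [Set.Finite.mem_toFinset] at hν
      have hcard := card_filter_card_fiber_eq (α := Fin n) ν (by rw [hν.2.2, Fintype.card_fin])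
      rw [Fintype.card_fin] at hcard
      rw [← hcard, Finset.filter_filter]
      congr 1
      ext f
      simp only [Finset.mem_filter, Finset.mem_univ, true_and]
      rw [← card_fiber_mem_regionProfiles_iff, funext_iff]
      refine ⟨And.right, fun h => ⟨?_, h⟩⟩
      rwa [funext h]
    · intro f hf
      rw [Finset.mem_coe, Set.Finite.mem_toFinset, card_fiber_mem_regionProfiles_iff]
      exact (Finset.mem_filter.1 hf).2
end
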